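/- Let e ≥ 2 be an even integer, t ∈ ℕ, μ = (μ¹, μ²) a bipartition, and λ = ϖ_t(μ). Write τ_e(λ, 0) = (λ^[e], s) with s = (s_1, …, s_e) ∈ ℤ^e, and write τ_{e/2}(μ¹, σ_1) = (ν¹, u¹) and τ_{e/2}(μ², σ_2) = (ν², u²), where σ_t = (σ_1, σ_2). Then for every p with 1 ≤ p ≤ e/2 one has u¹_p = s_{2p−1} and u²_p = s_{2p}; that is, the charge s of the e-quotient of λ is the interleaving of the charges of the e/2-quotients of the charged bipartition components (μ¹, σ_1) and (μ², σ_2). -/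

import Mathlib

/-- A partition, as a weakly decreasing, eventually zero, sequence of natural numbers.
Here `part u` is the `(u+1)`-st part `λ_{u+1}`. -/
structure PPartition where
  part : ℕ → ℕ
  antitone' : Antitone part
  eventually_zero : ∃ N, part N = 0

namespace PPartition

/-- The Young diagram of a partition, with boxes indexed from `0`:
the box `(x, y)` (1-indexed `(x+1, y+1)`) belongs to `Y(λ)` iff `y < λ_{x+1}`.
The content `y - x` of a box is independent of the indexing convention. -/
def ydiag (lam : PPartition) : Set (ℕ × ℕ) :=
  {p | p.2 < lam.part p.1}

/-- The weight `|λ|` of a partition. -/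
noncomputable def size (lam : PPartition) : ℕ :=
  ∑ᶠ u, lam.part u

/-- The β-set `β_d(λ) = {λ_u + d + 1 - u : u ≥ 1}` of the charged partition `(λ, d)`. -/
def bset (lam : PPartition) (d : ℤ) : Set ℤ :=
  {z | ∃ u : ℕ, z = (lam.part u : ℤ) + d - u}

/-- `λ` is an `e`-core: it has no `e`-hook, i.e. there is no `x` with
`x + e ∈ β(λ)`, `x ∉ β(λ)` (this does not depend on the charge; we use charge `0`). -/
def IsECore (e : ℕ) (lam : PPartition) : Prop :=
  ∀ x : ℤ, x + e ∈ lam.bset 0 → x ∈ lam.bset 0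

/-- `mu` is obtained from `lam` by removing one `e`-hook, i.e. by replacing some
`x + e` by `x` in the β-set. -/
def RemoveHookRel (e : ℕ) (lam mu : PPartition) : Prop :=
  ∃ x : ℤ, x + e ∈ lam.bset 0 ∧ x ∉ lam.bset 0 ∧
    mu.bset 0 = insert x (lam.bset 0 \ {x + e})

/-- `nu` is obtained from `lam` by successively removing `w` `e`-hooks.
If moreover `nu` is an `e`-core, then `nu = λ_[e]` is the `e`-core of `lam` and
`w = w_e(λ)` is its `e`-weight. -/
def HookChainTo (e : ℕ) (lam nu : PPartition) (w : ℕ) : Prop :=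
  ∃ c : ℕ → PPartition, c 0 = lam ∧ c w = nu ∧
    ∀ i < w, RemoveHookRel e (c i) (c (i + 1))

/-- The staircase partition `Δ_t = (t, t-1, …, 1)`. -/
def staircase (t : ℕ) : PPartition where
  part u := t - u
  antitone' := by
    intro a b hab
    show t - b ≤ t - a
    omega
  eventually_zero := ⟨t, Nat.sub_self t⟩

/-- `τ_e(λ, d) = (μ, s)`: the `e`-quotient/`e`-charge decomposition of the charged
partition `(λ, d)`, characterized by `∑ s_p = d` and
`β_d(λ) = ⊔_{p=1}^e (p - e + e β_{s_p}(μ^p))` (here `p = j + 1` for `j : Fin e`). -/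
def QuotientDecomp (e : ℕ) (lam : PPartition) (d : ℤ) (mu : Fin e → PPartition)
    (s : Fin e → ℤ) : Prop :=
  (∑ j, s j) = d ∧
  lam.bset d = ⋃ j : Fin e,
    (fun z => ((j : ℕ) : ℤ) + 1 - (e : ℤ) + (e : ℤ) * z) '' ((mu j).bset (s j))

/-- The empty partition. -/
def empty : PPartition where
  part _ := 0
  antitone' := antitone_const
  eventually_zero := ⟨0, rfl⟩

/-- The 2-charge `σ_t` of the staircase `Δ_t`:
`σ_t = (-t/2, t/2)` if `t` is even, `σ_t = ((1+t)/2, -(1+t)/2)` if `t` is odd. -/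
def sigmaT (t : ℕ) : ℤ × ℤ :=
  if Even t then (-((t : ℤ) / 2), (t : ℤ) / 2)
  else ((1 + (t : ℤ)) / 2, -((1 + (t : ℤ)) / 2))

/-- The quantity `Δ(s, e)` of the paper, for a charge `s = (s_1, …, s_l)`:
`Δ(s,e) = ½ ∑_j ( s̄_j (1 - s̄_j/e) + s_j (s_j/e - 1) )`, where `s̄_j ∈ [0, e)`
is the residue of `s_j` modulo `e`. -/
def paperDelta {l : ℕ} (s : Fin l → ℤ) (e : ℕ) : ℚ :=
  (1 / 2) * ∑ j, ((((s j) % (e : ℤ) : ℤ) : ℚ) * (1 - (((s j) % (e : ℤ) : ℤ) : ℚ) / (e : ℚ))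
    + ((s j : ℚ)) * ((s j : ℚ) / (e : ℚ) - 1))

end PPartition

namespace PPartition

theorem bset_eq_range (lam : PPartition) (d : ℤ) :
    lam.bset d = Set.range fun u : ℕ => (lam.part u : ℤ) + d - u := by
  ext z
  simp only [bset, Set.mem_ofPred_eq, Set.mem_range, eq_comm]

theorem strictAnti_beta (lam : PPartition) (d : ℤ) :
    StrictAnti fun u : ℕ => (lam.part u : ℤ) + d - u := by
  intro a b hab
  have := lam.antitone' hab.le
  dsimp only
  omega

/-- The β-set of a charged partition determines its charge. -/
theorem charge_eq_of_bset_eq {lam mu : PPartition} {d d' : ℤ}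
    (h : lam.bset d = mu.bset d') : d = d' := by
  rw [bset_eq_range, bset_eq_range] at h
  have hfun : (fun u : ℕ => -((lam.part u : ℤ) + d - u)) =
      fun u : ℕ => -((mu.part u : ℤ) + d' - u) := by
    refine (StrictMono.range_inj (strictAnti_beta lam d).neg (strictAnti_beta mu d').neg).1 ?_
    have := congrArg (Set.image Neg.neg) h
    rwa [← Set.range_comp, ← Set.range_comp] at this
  obtain ⟨M, hM⟩ := lam.eventually_zero
  obtain ⟨N, hN⟩ := mu.eventually_zero
  have hl := lam.antitone' (le_max_left M N)
  have hm := mu.antitone' (le_max_right M N)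
  have := congrFun hfun (max M N)
  omega

/-- A runner of the `e`-abacus is the β-set of the corresponding component of the
`e`-quotient. -/
theorem QuotientDecomp.mem_bset_iff {e : ℕ} {lam : PPartition} {d : ℤ}
    {mu : Fin e → PPartition} {s : Fin e → ℤ} (h : QuotientDecomp e lam d mu s)
    (j : Fin e) (z : ℤ) :
    z ∈ (mu j).bset (s j) ↔ ((j : ℕ) : ℤ) + 1 - (e : ℤ) + (e : ℤ) * z ∈ lam.bset d := by
  rw [h.2, Set.mem_iUnion]
  refine ⟨fun hz => ⟨j, z, hz, rfl⟩, ?_⟩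
  rintro ⟨i, w, hw, heq⟩
  dsimp only at heq
  have he : (e : ℤ) ≠ 0 := by have := j.pos; omega
  have hmod : ((i : ℕ) : ℤ) = ((j : ℕ) : ℤ) := by
    have hi : ((i : ℕ) : ℤ) % e = i := Int.emod_eq_of_lt (by omega) (by omega)
    have hj : ((j : ℕ) : ℤ) % e = j := Int.emod_eq_of_lt (by omega) (by omega)
    have hdvd : (e : ℤ) ∣ (i : ℤ) - (j : ℤ) := ⟨z - w, by linarith⟩
    rw [← hi, ← hj]
    exact Int.emod_eq_emod_iff_emod_sub_eq_zero.2 (Int.emod_eq_zero_of_dvd hdvd)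
  have hij : i = j := Fin.ext (by exact_mod_cast hmod)
  subst hij
  have : w = z := mul_left_cancel₀ he (by linarith)
  exact this ▸ hw

end PPartition

open PPartition in
/-- Lemma `lem:ecore2core`(a): let `e` be even, `μ = (μ¹, μ²)` a bipartition and
`λ = ϖ_t(μ)` (i.e. `τ_2(λ, 0) = (μ, σ_t)`). Write `τ_e(λ, 0) = (λ^[e], s)`,
`τ_{e/2}(μ¹, σ_1) = (ν¹, u¹)` and `τ_{e/2}(μ², σ_2) = (ν², u²)`, where
`σ_t = (σ_1, σ_2)`. Then `u¹_p = s_{2p-1}` and `u²_p = s_{2p}` (1-based indexing):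
the charge `s` is the interleaving of the charges `u¹` and `u²`. -/
theorem statement12 (e f : ℕ) (hf : 0 < f) (he : e = 2 * f) (t : ℕ)
    (mu1 mu2 : PPartition) (lam : PPartition)
    (hlam : QuotientDecomp 2 lam 0 ![mu1, mu2] ![(sigmaT t).1, (sigmaT t).2])
    (nu : Fin e → PPartition) (s : Fin e → ℤ)
    (hquot : QuotientDecomp e lam 0 nu s)
    (nu1 : Fin f → PPartition) (u1 : Fin f → ℤ)
    (h1 : QuotientDecomp f mu1 (sigmaT t).1 nu1 u1)
    (nu2 : Fin f → PPartition) (u2 : Fin f → ℤ)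
    (h2 : QuotientDecomp f mu2 (sigmaT t).2 nu2 u2) :
    ∀ p : Fin f,
      u1 p = s ⟨2 * (p : ℕ), by omega⟩ ∧
      u2 p = s ⟨2 * (p : ℕ) + 1, by omega⟩ := by
  subst he
  intro p
  constructor
  · refine charge_eq_of_bset_eq (lam := nu1 p) (mu := nu ⟨2 * (p : ℕ), by omega⟩) ?_
    ext z
    have h0 := hlam.mem_bset_iff 0 ((p : ℕ) + 1 - f + f * z)
    rw [h1.mem_bset_iff, hquot.mem_bset_iff]
    refine h0.trans (iff_of_eq (congrArg (· ∈ lam.bset 0) ?_))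
    push_cast [Fin.val_zero]
    ring
  · refine charge_eq_of_bset_eq (lam := nu2 p) (mu := nu ⟨2 * (p : ℕ) + 1, by omega⟩) ?_
    ext z
    have h0 := hlam.mem_bset_iff 1 ((p : ℕ) + 1 - f + f * z)
    rw [h2.mem_bset_iff, hquot.mem_bset_iff]
    refine h0.trans (iff_of_eq (congrArg (· ∈ lam.bset 0) ?_))
    push_cast [Fin.val_one]
    ring
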